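/- arXiv:2108.08293 — 2 statements merged into one kernel-verified Lean document; each statement's English description precedes it below -/
import Mathlib

section
/- Any two triangles are pedal equivalent: if V = (V_1,V_2,V_3) and W = (W_1,W_2,W_3) are 3-gons in ℝ², each with affinely independent vertices, then V ⊥ W. Consequently the quotient of the set of nondegenerate triangles by the relation ⊥ has exactly one element. -/
open scoped InnerProductSpace

noncomputable section

/-- The Euclidean plane. -/
abbrev Plane := EuclideanSpace ℝ (Fin 2)

/-- The foot of the perpendicular from `X` to the line through `A` and `B`
(the orthogonal projection of `X` onto that line, when `A ≠ B`). -/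
noncomputable def foot (A B X : Plane) : Plane :=
  A + (⟪X - A, B - A⟫_ℝ / ⟪B - A, B - A⟫_ℝ) • (B - A)

/-- The pedal polygon of the `n`-gon `V` with respect to the point `X`:
its `i`-th vertex is the orthogonal projection of `X` onto the line through
`V i` and `V (i+1)` (indices mod `n`). -/
noncomputable def pedal {n : ℕ} (V : ZMod n → Plane) (X : Plane) : ZMod n → Plane :=
  fun i => foot (V i) (V (i + 1)) X

/-- No three successive vertices of the `n`-gon `V` are collinear. -/
def NoThreeCollinear {n : ℕ} (V : ZMod n → Plane) : Prop :=
  ∀ i : ZMod n, ¬ Collinear ℝ ({V i, V (i + 1), V (i + 2)} : Set Plane)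

/-- Two `n`-gons are similar: there are `k > 0` and a bijection `τ` of `ZMod n` of the
form `τ i = c + i` or `τ i = c - i` such that `dist (P (τ i)) (P (τ j)) = k * dist (W i) (W j)`. -/
def SimilarGon {n : ℕ} (P W : ZMod n → Plane) : Prop :=
  ∃ k : ℝ, 0 < k ∧ ∃ c : ZMod n,
    ((∀ i j : ZMod n, dist (P (c + i)) (P (c + j)) = k * dist (W i) (W j)) ∨
     (∀ i j : ZMod n, dist (P (c - i)) (P (c - j)) = k * dist (W i) (W j)))

/-- The sequence of iterated pedal polygons of `V` with respect to the points
`X 1, X 2, …` : `pedalSeq V X 0 = V` and `pedalSeq V X k = pedal (pedalSeq V X (k-1)) (X k)`. -/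
noncomputable def pedalSeq {n : ℕ} (V : ZMod n → Plane) (X : ℕ → Plane) : ℕ → ZMod n → Plane
  | 0 => V
  | k + 1 => pedal (pedalSeq V X k) (X (k + 1))

/-- `V` and `W` are pedal equivalent (`V ⊥ W`): some iterated pedal polygon of `V`
(all of whose stages have no three successive vertices collinear) is similar to `W`. -/
def PedalEquiv {n : ℕ} (V W : ZMod n → Plane) : Prop :=
  ∃ m : ℕ, 1 ≤ m ∧ ∃ X : ℕ → Plane,
    (∀ k : ℕ, 1 ≤ k → k ≤ m → NoThreeCollinear (pedalSeq V X k)) ∧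
    SimilarGon (pedalSeq V X m) W

/-- The set of nondegenerate triangles. -/
def Triangle3 : Type := {U : ZMod 3 → Plane // AffineIndependent ℝ U}

/-- Twice the signed area of the triangle `A B C`. -/
def cross (A B C : Plane) : ℝ :=
  (B 0 - A 0) * (C 1 - A 1) - (B 1 - A 1) * (C 0 - A 0)

/-- The point of the complex plane with the coordinates of `p`. -/
def toComplex (p : Plane) : ℂ := ⟨p 0, p 1⟩

theorem dist_sq_eq (p q : Plane) : dist p q ^ 2 = (p 0 - q 0) ^ 2 + (p 1 - q 1) ^ 2 := by
  rw [EuclideanSpace.dist_eq, Real.sq_sqrt (by positivity)]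
  simp [Fin.sum_univ_two, Real.dist_eq, sq_abs]

theorem dist_eq_norm_toComplex_sub (p q : Plane) : dist p q = ‖toComplex p - toComplex q‖ := by
  rw [← sq_eq_sq₀ dist_nonneg (norm_nonneg _), dist_sq_eq, Complex.sq_norm, Complex.normSq_apply]
  simp only [toComplex, Complex.sub_re, Complex.sub_im]
  ring

theorem collinear_of_cross_eq_zero {A B C : Plane} (h : cross A B C = 0) :
    Collinear ℝ ({A, B, C} : Set Plane) := by
  by_cases hAB : B = A
  · subst hAB
    simpa using collinear_pair ℝ B C
  rw [collinear_iff_of_mem (p₀ := A) (by simp)]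
  have hd : (B 0 - A 0) ^ 2 + (B 1 - A 1) ^ 2 ≠ 0 := by
    rw [← dist_sq_eq]
    exact pow_ne_zero _ (dist_ne_zero.2 hAB)
  refine ⟨B - A, ?_⟩
  simp only [Set.mem_insert_iff, Set.mem_singleton_iff, forall_eq_or_imp, forall_eq]
  refine ⟨⟨0, by simp⟩, ⟨1, by simp⟩,
    ⟨((C 0 - A 0) * (B 0 - A 0) + (C 1 - A 1) * (B 1 - A 1)) /
      ((B 0 - A 0) ^ 2 + (B 1 - A 1) ^ 2), ?_⟩⟩
  unfold cross at h
  ext i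
  fin_cases i
  · simp only [Fin.zero_eta, vadd_eq_add, PiLp.add_apply, PiLp.smul_apply, PiLp.sub_apply,
      smul_eq_mul]
    field_simp
    linear_combination (-(B 1 - A 1)) * h
  · simp only [Fin.mk_one, vadd_eq_add, PiLp.add_apply, PiLp.smul_apply, PiLp.sub_apply,
      smul_eq_mul]
    field_simp
    linear_combination (B 0 - A 0) * h

theorem cross_eq_zero_of_collinear {A B C : Plane}
    (h : Collinear ℝ ({A, B, C} : Set Plane)) : cross A B C = 0 := by
  rw [collinear_iff_of_mem (p₀ := A) (by simp)] at h
  obtain ⟨v, hv⟩ := h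
  obtain ⟨r, hr⟩ := hv B (by simp)
  obtain ⟨s, hs⟩ := hv C (by simp)
  subst hr hs
  simp only [cross, vadd_eq_add, PiLp.add_apply, PiLp.smul_apply, smul_eq_mul]
  ring

theorem cross_ne_zero_of_affineIndependent {V : ZMod 3 → Plane} (hV : AffineIndependent ℝ V) :
    cross (V 0) (V 1) (V 2) ≠ 0 := by
  intro h
  refine affineIndependent_iff_not_collinear_set.1 ?_ (collinear_of_cross_eq_zero h)
  have h : (![V 0, V 1, V 2] : Fin 3 → Plane) = V := by
    funext i
    fin_cases i <;> rfl
  rw [h]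
  exact hV

/-- Heron's formula. -/
theorem four_mul_cross_sq (A B C : Plane) :
    4 * cross A B C ^ 2 =
      4 * dist A B ^ 2 * dist A C ^ 2 - (dist A B ^ 2 + dist A C ^ 2 - dist B C ^ 2) ^ 2 := by
  simp only [dist_sq_eq, cross]
  ring

theorem dist_sq_foot_mul {A B C : Plane} (X : Plane) (hAB : A ≠ B) (hBC : B ≠ C) :
    dist (foot A B X) (foot B C X) ^ 2 * (dist A B ^ 2 * dist B C ^ 2) =
      dist X B ^ 2 * cross A B C ^ 2 := by
  have h₁ : (B 0 - A 0) ^ 2 + (B 1 - A 1) ^ 2 ≠ 0 := by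
    rw [← dist_sq_eq]
    exact pow_ne_zero _ (dist_ne_zero.2 hAB.symm)
  have h₂ : (C 0 - B 0) ^ 2 + (C 1 - B 1) ^ 2 ≠ 0 := by
    rw [← dist_sq_eq]
    exact pow_ne_zero _ (dist_ne_zero.2 hBC.symm)
  have inner_eq (u v : Plane) : ⟪u, v⟫_ℝ = u 0 * v 0 + u 1 * v 1 := by
    simp [PiLp.inner_apply, Fin.sum_univ_two, mul_comm]
  simp only [dist_sq_eq, foot, cross, inner_eq, PiLp.add_apply, PiLp.smul_apply, PiLp.sub_apply,
    smul_eq_mul, ← pow_two]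
  obtain ⟨p₀, hp₀⟩ : ∃ p, B 0 - A 0 = p := ⟨_, rfl⟩
  obtain ⟨p₁, hp₁⟩ : ∃ p, B 1 - A 1 = p := ⟨_, rfl⟩
  obtain ⟨q₀, hq₀⟩ : ∃ q, C 0 - B 0 = q := ⟨_, rfl⟩
  obtain ⟨q₁, hq₁⟩ : ∃ q, C 1 - B 1 = q := ⟨_, rfl⟩
  obtain ⟨y₀, hy₀⟩ : ∃ y, X 0 - B 0 = y := ⟨_, rfl⟩
  obtain ⟨y₁, hy₁⟩ : ∃ y, X 1 - B 1 = y := ⟨_, rfl⟩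
  rw [hp₀, hp₁] at h₁
  rw [hq₀, hq₁] at h₂
  rw [show X 0 - A 0 = y₀ + p₀ by linarith, show X 1 - A 1 = y₁ + p₁ by linarith,
    show C 0 - A 0 = p₀ + q₀ by linarith, show C 1 - A 1 = p₁ + q₁ by linarith,
    show A 0 - B 0 = -p₀ by linarith, show A 1 - B 1 = -p₁ by linarith,
    show B 0 - C 0 = -q₀ by linarith, show B 1 - C 1 = -q₁ by linarith,
    hp₀, hp₁, hq₀, hq₁, hy₀, hy₁,
    show A 0 = B 0 - p₀ by linarith, show A 1 = B 1 - p₁ by linarith]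
  obtain ⟨s, hs⟩ : ∃ s, ((y₀ + p₀) * p₀ + (y₁ + p₁) * p₁) / (p₀ ^ 2 + p₁ ^ 2) = 1 + s :=
    ⟨_, (add_sub_cancel _ _).symm⟩
  obtain ⟨t, ht⟩ : ∃ t, (y₀ * q₀ + y₁ * q₁) / (q₀ ^ 2 + q₁ ^ 2) = t := ⟨_, rfl⟩
  rw [hs, ht]
  rw [div_eq_iff h₁] at hs
  rw [div_eq_iff h₂] at ht
  replace hs : s * (p₀ ^ 2 + p₁ ^ 2) = y₀ * p₀ + y₁ * p₁ := by linear_combination -hs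
  calc _ = (s * (p₀ ^ 2 + p₁ ^ 2)) ^ 2 * (q₀ ^ 2 + q₁ ^ 2)
        + (t * (q₀ ^ 2 + q₁ ^ 2)) ^ 2 * (p₀ ^ 2 + p₁ ^ 2)
        - 2 * (s * (p₀ ^ 2 + p₁ ^ 2)) * (t * (q₀ ^ 2 + q₁ ^ 2)) * (p₀ * q₀ + p₁ * q₁) := by ring
    _ = _ := by
      rw [hs, ← ht]
      ring

/-- The complex form of the existence of a point whose distances to the vertices of a triangle
are in prescribed ratio. -/
theorem exists_mul_eq_mul {v₀ v₁ v₂ α β γ : ℂ} (h₀₁ : v₀ ≠ v₁) (h₁₂ : v₁ ≠ v₂) (h₂₀ : v₂ ≠ v₀)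
    (hsum : α + β + γ = 0) (hdet : (v₂ - v₀) * α - (v₁ - v₂) * β ≠ 0) :
    ∃ x l : ℂ, l ≠ 0 ∧ (x - v₀) * (v₁ - v₂) = l * α ∧ (x - v₁) * (v₂ - v₀) = l * β ∧
      (x - v₂) * (v₀ - v₁) = l * γ := by
  have e₀ := sub_ne_zero.2 h₀₁
  have e₁ := sub_ne_zero.2 h₁₂
  have e₂ := sub_ne_zero.2 h₂₀
  refine ⟨(v₁ * (v₂ - v₀) * α - v₀ * (v₁ - v₂) * β) / ((v₂ - v₀) * α - (v₁ - v₂) * β),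
    (v₁ - v₀) * (v₂ - v₀) * (v₁ - v₂) / ((v₂ - v₀) * α - (v₁ - v₂) * β), ?_, ?_, ?_, ?_⟩
  · exact div_ne_zero (mul_ne_zero (mul_ne_zero (sub_ne_zero.2 h₀₁.symm) e₂) e₁) hdet
  · field_simp
    ring
  · field_simp
    ring
  · obtain rfl : γ = -α - β := by linear_combination hsum
    field_simp
    ring

theorem exists_norm_mul_eq {v₀ v₁ v₂ α β γ : ℂ} (h₀₁ : v₀ ≠ v₁) (h₁₂ : v₁ ≠ v₂) (h₂₀ : v₂ ≠ v₀)
    (hsum : α + β + γ = 0) (him : α.re * β.im - α.im * β.re ≠ 0) :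
    ∃ x : ℂ, ∃ l : ℝ, 0 < l ∧ ‖x - v₀‖ * ‖v₁ - v₂‖ = l * ‖α‖ ∧
      ‖x - v₁‖ * ‖v₂ - v₀‖ = l * ‖β‖ ∧ ‖x - v₂‖ * ‖v₀ - v₁‖ = l * ‖γ‖ := by
  obtain ⟨α', β', γ', hα, hβ, hγ, hsum', hdet⟩ : ∃ α' β' γ' : ℂ, ‖α'‖ = ‖α‖ ∧ ‖β'‖ = ‖β‖ ∧
      ‖γ'‖ = ‖γ‖ ∧ α' + β' + γ' = 0 ∧ (v₂ - v₀) * α' - (v₁ - v₂) * β' ≠ 0 := by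
    by_cases hdet : (v₂ - v₀) * α - (v₁ - v₂) * β = 0
    · refine ⟨starRingEnd ℂ α, starRingEnd ℂ β, starRingEnd ℂ γ, RCLike.norm_conj _,
        RCLike.norm_conj _, RCLike.norm_conj _, by rw [← map_add, ← map_add, hsum, map_zero],
        fun hconj => him ?_⟩
      have h : (v₂ - v₀) * (α * starRingEnd ℂ β - starRingEnd ℂ α * β) = 0 := by
        linear_combination starRingEnd ℂ β * hdet - β * hconj
      have h' := (mul_eq_zero.1 h).resolve_left (sub_ne_zero.2 h₂₀)
      have h'' := congrArg Complex.im h'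
      simp only [Complex.sub_im, Complex.mul_im, Complex.conj_re, Complex.conj_im,
        Complex.zero_im] at h''
      linarith
    · exact ⟨α, β, γ, rfl, rfl, rfl, hsum, hdet⟩
  obtain ⟨x, l, hl, e₀, e₁, e₂⟩ := exists_mul_eq_mul h₀₁ h₁₂ h₂₀ hsum' hdet
  refine ⟨x, ‖l‖, norm_pos_iff.2 hl, ?_, ?_, ?_⟩
  · rw [← norm_mul, e₀, norm_mul, hα]
  · rw [← norm_mul, e₁, norm_mul, hβ]
  · rw [← norm_mul, e₂, norm_mul, hγ]

/-- Some pedal triangle of `A B C` is similar to a given nondegenerate triangle `D E F`. -/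
theorem exists_dist_foot_eq {A B C D E F : Plane} (hV : cross A B C ≠ 0) (hW : cross D E F ≠ 0) :
    ∃ X : Plane, ∃ k : ℝ, 0 < k ∧ dist (foot A B X) (foot B C X) = k * dist D E ∧
      dist (foot B C X) (foot C A X) = k * dist E F ∧
      dist (foot C A X) (foot A B X) = k * dist F D := by
  have hAB : A ≠ B := by rintro rfl; exact hV (by simp [cross])
  have hBC : B ≠ C := by rintro rfl; exact hV (by simp [cross]; ring)
  have hCA : C ≠ A := by rintro rfl; exact hV (by simp [cross])
  have hne {p q : Plane} (h : p ≠ q) : toComplex p ≠ toComplex q := by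
    rw [← sub_ne_zero, ← norm_pos_iff, ← dist_eq_norm_toComplex_sub]
    exact dist_pos.2 h
  obtain ⟨x, l, hl, e₀, e₁, e₂⟩ := exists_norm_mul_eq (hne hAB) (hne hBC) (hne hCA)
    (α := toComplex F - toComplex D) (β := toComplex D - toComplex E)
    (γ := toComplex E - toComplex F) (by ring) (by
      simp only [toComplex, Complex.sub_re, Complex.sub_im]
      intro h
      apply hW
      unfold cross
      linear_combination h)
  obtain ⟨X, rfl⟩ : ∃ X : Plane, toComplex X = x := ⟨!₂[x.re, x.im], by simp [toComplex]⟩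
  simp only [← dist_eq_norm_toComplex_sub] at e₀ e₁ e₂
  have pAB := dist_pos.2 hAB
  have pBC := dist_pos.2 hBC
  have pCA := dist_pos.2 hCA
  have hside {P Q R : Plane} (hPQ : P ≠ Q) (hQR : Q ≠ R) {d : ℝ} (hd : 0 ≤ d)
      (hcross : cross P Q R = cross A B C) (hRP : 0 < dist R P)
      (hprod : dist P Q * dist Q R * dist R P = dist A B * dist B C * dist C A)
      (h : dist X Q * dist R P = l * d) :
      dist (foot P Q X) (foot Q R X) =
        l * |cross A B C| / (dist A B * dist B C * dist C A) * d := by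
    have hf := dist_sq_foot_mul X hPQ hQR
    have pPQ := dist_pos.2 hPQ
    have pQR := dist_pos.2 hQR
    rw [← hprod, ← hcross, div_mul_eq_mul_div, eq_div_iff (by positivity),
      ← sq_eq_sq₀ (by positivity) (by positivity)]
    calc _ = dist (foot P Q X) (foot Q R X) ^ 2 * (dist P Q ^ 2 * dist Q R ^ 2) * dist R P ^ 2 := by
          ring
      _ = (dist X Q * dist R P) ^ 2 * cross P Q R ^ 2 := by rw [hf]; ring
      _ = _ := by rw [h, ← sq_abs (cross P Q R)]; ring
  refine ⟨X, l * |cross A B C| / (dist A B * dist B C * dist C A), by positivity, ?_, ?_, ?_⟩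
  · exact hside hAB hBC dist_nonneg rfl pCA rfl e₁
  · exact hside hBC hCA dist_nonneg (by unfold cross; ring) pAB (by ring) e₂
  · exact hside hCA hAB dist_nonneg (by unfold cross; ring) pBC (by ring) e₀

theorem pedalEquiv_of_affineIndependent {V W : ZMod 3 → Plane}
    (hV : AffineIndependent ℝ V) (hW : AffineIndependent ℝ W) : PedalEquiv V W := by
  have hW' := cross_ne_zero_of_affineIndependent hW
  obtain ⟨X, k, hk, h₀₁, h₁₂, h₂₀⟩ :=
    exists_dist_foot_eq (cross_ne_zero_of_affineIndependent hV) hW'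
  set P := pedal V X with hP
  replace h₀₁ : dist (P 0) (P 1) = k * dist (W 0) (W 1) := h₀₁
  replace h₁₂ : dist (P 1) (P 2) = k * dist (W 1) (W 2) := h₁₂
  replace h₂₀ : dist (P 2) (P 0) = k * dist (W 2) (W 0) := h₂₀
  have hsim : ∀ i j : ZMod 3, dist (P i) (P j) = k * dist (W i) (W j) := by
    intro i j
    fin_cases i <;> fin_cases j
    · exact (dist_self (P 0)).trans (by simp)
    · exact h₀₁
    · exact (dist_comm (P 0) (P 2)).trans (h₂₀.trans (by rw [dist_comm]; rfl))
    · exact (dist_comm (P 1) (P 0)).trans (h₀₁.trans (by rw [dist_comm]; rfl))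
    · exact (dist_self (P 1)).trans (by simp)
    · exact h₁₂
    · exact h₂₀
    · exact (dist_comm (P 2) (P 1)).trans (h₁₂.trans (by rw [dist_comm]; rfl))
    · exact (dist_self (P 2)).trans (by simp)
  have hP' : cross (P 0) (P 1) (P 2) ≠ 0 := by
    intro h
    have h₁ := four_mul_cross_sq (P 0) (P 1) (P 2)
    rw [hsim, hsim, hsim, h] at h₁
    have h₂ : k ^ 4 * (4 * cross (W 0) (W 1) (W 2) ^ 2) = 0 := by
      rw [four_mul_cross_sq]
      linear_combination -h₁
    have : 0 < k ^ 4 * (4 * cross (W 0) (W 1) (W 2) ^ 2) := by positivity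
    exact this.ne' h₂
  refine ⟨1, le_rfl, fun _ => X, fun m hm₁ hm₂ => ?_, k, hk, 0, Or.inl fun i j => ?_⟩
  · obtain rfl : m = 1 := le_antisymm hm₂ hm₁
    change NoThreeCollinear P
    intro i hi
    have h := cross_eq_zero_of_collinear hi
    apply hP'
    fin_cases i
    · exact h
    · replace h : cross (P 1) (P 2) (P 0) = 0 := h
      rw [← h]
      unfold cross
      ring
    · replace h : cross (P 2) (P 0) (P 1) = 0 := h
      rw [← h]
      unfold cross
      ring
  · rw [zero_add, zero_add]
    exact hsim i j

/-- **Any two nondegenerate triangles are pedal equivalent**, and consequently the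
quotient of the set of nondegenerate triangles by pedal equivalence has exactly one
element. -/
theorem triangles_pedalEquiv
    (V W : ZMod 3 → Plane)
    (hV : AffineIndependent ℝ V) (hW : AffineIndependent ℝ W) :
    PedalEquiv V W ∧
    Nonempty (Quot fun A B : Triangle3 => PedalEquiv A.1 B.1) ∧
    ∀ a b : Quot fun A B : Triangle3 => PedalEquiv A.1 B.1, a = b := by
  exact ⟨pedalEquiv_of_affineIndependent hV hW, ⟨Quot.mk _ ⟨V, hV⟩⟩, fun a b =>
    Quot.induction_on₂ a b fun A B => Quot.sound (pedalEquiv_of_affineIndependent A.2 B.2)⟩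
end
end

section
/- Every kite is pedal equivalent to every square: if K = (K_1,K_2,K_3,K_4) is a kite and V = (V_1,V_2,V_3,V_4) is a square in ℝ², then K ⊥ V. -/
open scoped InnerProductSpace

noncomputable section

/-- A rectangle: a 4-gon with nonzero, pairwise-orthogonal consecutive edge vectors. -/
def IsRectangle (R : ZMod 4 → Plane) : Prop :=
  ∀ i : ZMod 4, R (i + 1) ≠ R i ∧ ⟪R (i + 1) - R i, R (i + 2) - R (i + 1)⟫_ℝ = 0

/-- A square: a rectangle all of whose sides have the same length. -/
def IsSquareGon (V : ZMod 4 → Plane) : Prop :=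
  IsRectangle V ∧ ∀ i j : ZMod 4, dist (V i) (V (i + 1)) = dist (V j) (V (j + 1))

/-- A kite: a 4-gon `(K₁,K₂,K₃,K₄)` (here indexed `0,1,2,3`) with no three successive
vertices collinear such that `dist K₁ K₂ = dist K₁ K₄` and `dist K₃ K₂ = dist K₃ K₄`. -/
def IsKite (K : ZMod 4 → Plane) : Prop :=
  NoThreeCollinear K ∧ dist (K 0) (K 1) = dist (K 0) (K 3) ∧
    dist (K 2) (K 1) = dist (K 2) (K 3)

/-- The point with coordinates `x`, `y` in the orthogonal frame with origin `O` whose second axis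
is `v` and whose first axis is `v` rotated by a right angle. -/
def framePoint (O v : Plane) (x y : ℝ) : Plane :=
  !₂[O 0 + x * v 1 + y * v 0, O 1 - x * v 0 + y * v 1]

/-- The quadrilateral with the given vertices. -/
def quad (A B C D : Plane) : ZMod 4 → Plane := ![A, B, C, D]

lemma plane_inner (A B : Plane) : ⟪A, B⟫_ℝ = A 0 * B 0 + A 1 * B 1 := by
  simp [PiLp.inner_apply, Fin.sum_univ_two, mul_comm]

lemma plane_dist_sq (A B : Plane) : dist A B ^ 2 = (A 0 - B 0) ^ 2 + (A 1 - B 1) ^ 2 := by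
  rw [EuclideanSpace.dist_eq, Real.sq_sqrt (by positivity)]
  simp [Fin.sum_univ_two, Real.dist_eq, sq_abs]

lemma plane_ext {A B : Plane} (h0 : A 0 = B 0) (h1 : A 1 = B 1) : A = B := by
  ext i
  fin_cases i
  · exact h0
  · exact h1

lemma plane_collinear_iff (A B C : Plane) :
    Collinear ℝ ({A, B, C} : Set Plane) ↔
      (B 0 - A 0) * (C 1 - A 1) - (B 1 - A 1) * (C 0 - A 0) = 0 := by
  rw [collinear_iff_of_mem (Set.mem_insert A _)]
  constructor
  · rintro ⟨v, h⟩
    obtain ⟨r, hr⟩ := h B (by simp)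
    obtain ⟨s, hs⟩ := h C (by simp)
    subst hr hs
    simp only [vadd_eq_add, PiLp.add_apply, PiLp.smul_apply, smul_eq_mul]
    ring
  · intro h
    by_cases hAB : A = B
    · refine ⟨C - A, ?_⟩
      rintro P (rfl | rfl | rfl)
      · exact ⟨0, by simp⟩
      · exact ⟨0, by simp [hAB]⟩
      · exact ⟨1, by simp⟩
    · refine ⟨B - A, ?_⟩
      have hn : (B 0 - A 0) ^ 2 + (B 1 - A 1) ^ 2 ≠ 0 := by
        intro h0
        apply hAB
        apply plane_ext <;> nlinarith [sq_nonneg (B 0 - A 0), sq_nonneg (B 1 - A 1)]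
      rintro P (rfl | rfl | rfl)
      · exact ⟨0, by simp⟩
      · exact ⟨1, by simp⟩
      · refine ⟨((B 0 - A 0) * (P 0 - A 0) + (B 1 - A 1) * (P 1 - A 1)) /
          ((B 0 - A 0) ^ 2 + (B 1 - A 1) ^ 2), ?_⟩
        apply plane_ext <;>
          simp only [vadd_eq_add, PiLp.add_apply, PiLp.smul_apply, PiLp.sub_apply, smul_eq_mul] <;>
          field_simp
        · linear_combination -(B 1 - A 1) * h
        · linear_combination (B 0 - A 0) * h

lemma sq_add_sq_ne_zero_of_ne {a b c d : ℝ} (h : a ≠ c ∨ b ≠ d) :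
    (c - a) ^ 2 + (d - b) ^ 2 ≠ 0 := by
  rcases h with h | h
  · have := sub_ne_zero.2 h.symm
    positivity
  · have := sub_ne_zero.2 h.symm
    positivity

section Frame

variable {O v : Plane}

lemma frame_collinear_iff (hv : v 0 ^ 2 + v 1 ^ 2 ≠ 0) (a b c d e f : ℝ) :
    Collinear ℝ ({framePoint O v a b, framePoint O v c d, framePoint O v e f} : Set Plane) ↔
      (c - a) * (f - b) - (d - b) * (e - a) = 0 := by
  rw [plane_collinear_iff]
  have key : (framePoint O v c d 0 - framePoint O v a b 0) *
        (framePoint O v e f 1 - framePoint O v a b 1) -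
      (framePoint O v c d 1 - framePoint O v a b 1) *
        (framePoint O v e f 0 - framePoint O v a b 0) =
      (v 0 ^ 2 + v 1 ^ 2) * ((c - a) * (f - b) - (d - b) * (e - a)) := by
    simp [framePoint]
    ring
  rw [key, mul_eq_zero, or_iff_right hv]

lemma frame_inner (a b c d a' b' c' d' : ℝ) :
    ⟪framePoint O v c d - framePoint O v a b, framePoint O v c' d' - framePoint O v a' b'⟫_ℝ =
      (v 0 ^ 2 + v 1 ^ 2) * ((c - a) * (c' - a') + (d - b) * (d' - b')) := by
  rw [plane_inner]
  simp [framePoint]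
  ring

lemma frame_dist_sq (a b c d : ℝ) :
    dist (framePoint O v a b) (framePoint O v c d) ^ 2 =
      (v 0 ^ 2 + v 1 ^ 2) * ((a - c) ^ 2 + (b - d) ^ 2) := by
  rw [plane_dist_sq]
  simp [framePoint]
  ring

lemma frame_foot (hv : v 0 ^ 2 + v 1 ^ 2 ≠ 0) {a b c d x y e f : ℝ}
    (hn : a ≠ c ∨ b ≠ d)
    (hl : (e - a) * (d - b) = (f - b) * (c - a))
    (hp : (x - e) * (c - a) + (y - f) * (d - b) = 0) :
    foot (framePoint O v a b) (framePoint O v c d) (framePoint O v x y) = framePoint O v e f := by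
  have hn := sq_add_sq_ne_zero_of_ne hn
  have ht : ⟪framePoint O v x y - framePoint O v a b,
        framePoint O v c d - framePoint O v a b⟫_ℝ /
      ⟪framePoint O v c d - framePoint O v a b, framePoint O v c d - framePoint O v a b⟫_ℝ =
      ((e - a) * (c - a) + (f - b) * (d - b)) / ((c - a) ^ 2 + (d - b) ^ 2) := by
    rw [frame_inner, frame_inner, mul_div_mul_left _ _ hv]
    congr 1
    · linear_combination hp
    · ring
  have he : e = a + ((e - a) * (c - a) + (f - b) * (d - b)) / ((c - a) ^ 2 + (d - b) ^ 2) *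
      (c - a) := by
    field_simp
    linear_combination (d - b) * hl
  have hf : f = b + ((e - a) * (c - a) + (f - b) * (d - b)) / ((c - a) ^ 2 + (d - b) ^ 2) *
      (d - b) := by
    field_simp
    linear_combination -(c - a) * hl
  unfold foot
  rw [ht]
  generalize ((e - a) * (c - a) + (f - b) * (d - b)) / ((c - a) ^ 2 + (d - b) ^ 2) = t at he hf
  rw [he, hf]
  apply plane_ext <;> simp [framePoint] <;> ring

end Frame

lemma pedal_quad (A B C D X : Plane) :
    pedal (quad A B C D) X = quad (foot A B X) (foot B C X) (foot C D X) (foot D A X) := by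
  funext i
  fin_cases i <;> rfl

lemma pedal_quad_eq {A B C D X P Q R S : Plane} (h0 : foot A B X = P) (h1 : foot B C X = Q)
    (h2 : foot C D X = R) (h3 : foot D A X = S) :
    pedal (quad A B C D) X = quad P Q R S := by
  rw [pedal_quad, h0, h1, h2, h3]

lemma noThreeCollinear_quad {A B C D : Plane}
    (h0 : ¬ Collinear ℝ ({A, B, C} : Set Plane)) (h1 : ¬ Collinear ℝ ({B, C, D} : Set Plane))
    (h2 : ¬ Collinear ℝ ({C, D, A} : Set Plane)) (h3 : ¬ Collinear ℝ ({D, A, B} : Set Plane)) :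
    NoThreeCollinear (quad A B C D) := by
  intro i
  fin_cases i
  · exact h0
  · exact h1
  · exact h2
  · exact h3

lemma IsSquareGon.dist_opposite {V : ZMod 4 → Plane} (hV : IsSquareGon V) (i : ZMod 4) :
    dist (V i) (V (i + 2)) = √2 * dist (V 0) (V 1) := by
  have hi : dist (V i) (V (i + 1)) = dist (V 0) (V 1) := hV.2 i 0
  have hi' : dist (V (i + 1)) (V (i + 2)) = dist (V 0) (V 1) := by
    have := hV.2 (i + 1) 0
    rwa [add_assoc, one_add_one_eq_two] at this
  have ho := (hV.1 i).2
  have h1 := plane_dist_sq (V i) (V (i + 1))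
  have h2 := plane_dist_sq (V (i + 1)) (V (i + 2))
  have h3 := plane_dist_sq (V i) (V (i + 2))
  rw [hi] at h1
  rw [hi'] at h2
  rw [plane_inner] at ho
  simp only [PiLp.sub_apply] at ho
  rw [← sq_eq_sq₀ dist_nonneg (by positivity), mul_pow, Real.sq_sqrt (by norm_num)]
  linear_combination h3 - h1 - h2 + 2 * ho

lemma IsSquareGon.similarGon {P V : ZMod 4 → Plane} (hP : IsSquareGon P) (hV : IsSquareGon V) :
    SimilarGon P V := by
  have hP0 : 0 < dist (P 0) (P 1) := dist_pos.2 (hP.1 0).1.symm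
  have hV0 : 0 < dist (V 0) (V 1) := dist_pos.2 (hV.1 0).1.symm
  refine ⟨dist (P 0) (P 1) / dist (V 0) (V 1), div_pos hP0 hV0, 0, Or.inl fun i j => ?_⟩
  rw [zero_add, zero_add]
  obtain ⟨k, rfl⟩ : ∃ k, j = i + k := ⟨j - i, by abel⟩
  have side (W : ZMod 4 → Plane) (hW : IsSquareGon W) (i : ZMod 4) :
      dist (W i) (W (i + 1)) = dist (W 0) (W 1) := hW.2 i 0
  have hk : k = 0 ∨ k = 1 ∨ k = 2 ∨ k = 3 := by
    revert k
    decide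
  rcases hk with rfl | rfl | rfl | rfl
  · simp
  · rw [side P hP, side V hV, div_mul_cancel₀ _ hV0.ne']
  · rw [hP.dist_opposite, hV.dist_opposite]
    field_simp
  · have h4 : i = i + 3 + 1 := by
      revert i
      decide
    have hPi := side P hP (i + 3)
    have hVi := side V hV (i + 3)
    rw [← h4, dist_comm] at hPi hVi
    rw [hPi, hVi, div_mul_cancel₀ _ hV0.ne']

lemma pedalSeq_succ {n : ℕ} (V : ZMod n → Plane) (X : Plane) (Y : ℕ → Plane) (k : ℕ) :
    pedalSeq V (fun j => if j = 1 then X else Y (j - 1)) (k + 1) =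
      pedalSeq (pedal V X) Y k := by
  induction k with
  | zero => simp [pedalSeq]
  | succ k ih =>
    rw [pedalSeq, ih, pedalSeq]
    simp

lemma PedalEquiv.of_pedal {n : ℕ} {V W : ZMod n → Plane} (X : Plane)
    (h : NoThreeCollinear (pedal V X)) (hW : PedalEquiv (pedal V X) W) : PedalEquiv V W := by
  obtain ⟨m, hm, Y, hY, hs⟩ := hW
  refine ⟨m + 1, by omega, fun j => if j = 1 then X else Y (j - 1), ?_, ?_⟩
  · intro k hk hkm
    obtain ⟨k, rfl⟩ : ∃ l, k = l + 1 := ⟨k - 1, by omega⟩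
    rw [pedalSeq_succ]
    rcases Nat.eq_zero_or_pos k with rfl | hk0
    · exact h
    · exact hY k hk0 (by omega)
  · rw [pedalSeq_succ]
    exact hs

lemma PedalEquiv.of_similarGon_pedal {n : ℕ} {V W : ZMod n → Plane} (X : Plane)
    (h : NoThreeCollinear (pedal V X)) (hs : SimilarGon (pedal V X) W) : PedalEquiv V W := by
  refine ⟨1, le_rfl, fun _ => X, ?_, hs⟩
  intro k hk hk1
  obtain rfl : k = 1 := le_antisymm hk1 hk
  exact h

lemma IsSquareGon.noThreeCollinear {V : ZMod 4 → Plane} (hV : IsSquareGon V) :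
    NoThreeCollinear V := by
  intro i h
  rw [plane_collinear_iff] at h
  have ho := (hV.1 i).2
  have h1 := plane_dist_sq (V i) (V (i + 1))
  have h2 := plane_dist_sq (V (i + 1)) (V (i + 2))
  have hd : dist (V (i + 1)) (V (i + 2)) = dist (V i) (V (i + 1)) := by
    have := hV.2 (i + 1) i
    rwa [add_assoc, one_add_one_eq_two] at this
  have hpos : 0 < dist (V i) (V (i + 1)) := dist_pos.2 (hV.1 i).1.symm
  rw [plane_inner] at ho
  simp only [PiLp.sub_apply] at ho
  rw [hd] at h2
  have h4 : (dist (V i) (V (i + 1)) ^ 2) * (dist (V i) (V (i + 1)) ^ 2) = 0 := by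
    nth_rewrite 1 [h1]
    rw [h2]
    linear_combination
      ((V (i + 1) 0 - V i 0) * (V (i + 2) 0 - V (i + 1) 0) +
        (V (i + 1) 1 - V i 1) * (V (i + 2) 1 - V (i + 1) 1)) * ho +
      ((V (i + 1) 0 - V i 0) * (V (i + 2) 1 - V i 1) -
        (V (i + 1) 1 - V i 1) * (V (i + 2) 0 - V i 0)) * h
  exact absurd h4 (by positivity)

lemma IsSquareGon.pedalEquiv_of_pedal {K V : ZMod 4 → Plane} (X : Plane)
    (hP : IsSquareGon (pedal K X)) (hV : IsSquareGon V) : PedalEquiv K V :=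
  .of_similarGon_pedal X hP.noThreeCollinear (hP.similarGon hV)

section Frame

variable {O v : Plane} {V : ZMod 4 → Plane}

/-- A parallelogram in frame coordinates, spanned by two orthogonal vectors of equal length, is a
square. -/
lemma isSquareGon_frame (hv : v 0 ^ 2 + v 1 ^ 2 ≠ 0) {a b c d e f g h : ℝ}
    (hn : a ≠ c ∨ b ≠ d) (he : e = c - (d - b) ∧ f = d + (c - a) ∨
      e = c + (d - b) ∧ f = d - (c - a))
    (hg : g = a + e - c) (hh : h = b + f - d) :
    IsSquareGon (quad (framePoint O v a b) (framePoint O v c d) (framePoint O v e f)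
      (framePoint O v g h)) := by
  subst hg hh
  have hn := sq_add_sq_ne_zero_of_ne hn
  have hne {x y z w : ℝ} (h : (x - z) ^ 2 + (y - w) ^ 2 = (c - a) ^ 2 + (d - b) ^ 2) :
      framePoint O v x y ≠ framePoint O v z w := by
    intro h0
    have h1 := frame_dist_sq (O := O) (v := v) x y z w
    rw [h0, dist_self, h, zero_pow two_ne_zero] at h1
    exact mul_ne_zero hv hn h1.symm
  have hdist {x y z w : ℝ} (h : (x - z) ^ 2 + (y - w) ^ 2 = (c - a) ^ 2 + (d - b) ^ 2) :
      dist (framePoint O v x y) (framePoint O v z w) =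
        √((v 0 ^ 2 + v 1 ^ 2) * ((c - a) ^ 2 + (d - b) ^ 2)) := by
    rw [← h, ← frame_dist_sq, Real.sqrt_sq dist_nonneg]
  have hin {x y z w x' y' : ℝ} (h : (z - x) * (x' - z) + (w - y) * (y' - w) = 0) :
      ⟪framePoint O v z w - framePoint O v x y, framePoint O v x' y' - framePoint O v z w⟫_ℝ
        = 0 := by
    rw [frame_inner, h, mul_zero]
  have key (i : ZMod 4) : dist (quad (framePoint O v a b) (framePoint O v c d)
      (framePoint O v e f) (framePoint O v (a + e - c) (b + f - d)) i)
      (quad (framePoint O v a b) (framePoint O v c d)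
        (framePoint O v e f) (framePoint O v (a + e - c) (b + f - d)) (i + 1)) =
      √((v 0 ^ 2 + v 1 ^ 2) * ((c - a) ^ 2 + (d - b) ^ 2)) := by
    rcases he with ⟨rfl, rfl⟩ | ⟨rfl, rfl⟩
    all_goals
      fin_cases i
      · exact hdist (by ring)
      · exact hdist (by ring)
      · exact hdist (by ring)
      · exact hdist (by ring)
  refine ⟨fun i => ?_, fun i j => by rw [key, key]⟩
  rcases he with ⟨rfl, rfl⟩ | ⟨rfl, rfl⟩
  all_goals
    fin_cases i
    · exact ⟨hne (by ring), hin (by ring)⟩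
    · exact ⟨hne (by ring), hin (by ring)⟩
    · exact ⟨hne (by ring), hin (by ring)⟩
    · exact ⟨hne (by ring), hin (by ring)⟩

lemma not_collinear_frame (hv : v 0 ^ 2 + v 1 ^ 2 ≠ 0) {a b c d e f : ℝ}
    (h : (c - a) * (f - b) - (d - b) * (e - a) ≠ 0) :
    ¬ Collinear ℝ ({framePoint O v a b, framePoint O v c d, framePoint O v e f} : Set Plane) :=
  fun h' => h ((frame_collinear_iff hv a b c d e f).1 h')

/-- Every rectangle is pedal equivalent to every square. -/
lemma pedalEquiv_rectangle (hv : v 0 ^ 2 + v 1 ^ 2 ≠ 0) (hV : IsSquareGon V) (m : ℝ) {w h : ℝ}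
    (hw : w ≠ 0) (hh : h ≠ 0) :
    PedalEquiv (quad (framePoint O v (m + w) h) (framePoint O v (m - w) h)
      (framePoint O v (m - w) (-h)) (framePoint O v (m + w) (-h))) V := by
  have hh2 : 0 < h ^ 2 := by positivity
  have hP (u : ℝ) : pedal (quad (framePoint O v (m + w) h) (framePoint O v (m - w) h)
      (framePoint O v (m - w) (-h)) (framePoint O v (m + w) (-h))) (framePoint O v (m + u) 0) =
      quad (framePoint O v (m + u) h) (framePoint O v (m - w) 0)
        (framePoint O v (m + u) (-h)) (framePoint O v (m + w) 0) := by
    refine pedal_quad_eq (frame_foot hv (Or.inl fun h => hw (by linarith)) ?_ ?_)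
      (frame_foot hv (Or.inr fun h => hh (by linarith)) ?_ ?_)
      (frame_foot hv (Or.inl fun h => hw (by linarith)) ?_ ?_)
      (frame_foot hv (Or.inr fun h => hh (by linarith)) ?_ ?_) <;> ring1
  by_cases hwh : w ^ 2 = h ^ 2
  · refine IsSquareGon.pedalEquiv_of_pedal (framePoint O v (m + 0) 0) ?_ hV
    rw [hP]
    refine isSquareGon_frame hv (Or.inr hh) ?_ (by ring) (by ring)
    · rcases sq_eq_sq_iff_eq_or_eq_neg.1 hwh with rfl | rfl
      · left
        constructor <;> ring
      · right
        constructor <;> ring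
  · obtain ⟨g, hg0, hg⟩ : ∃ g, 0 < g ∧ (g = w * h ∨ g = -(w * h)) :=
      ⟨|w * h|, by positivity, abs_choice _⟩
    obtain ⟨u, hu⟩ : ∃ u, u ^ 2 = w ^ 2 + g := ⟨√(w ^ 2 + g), Real.sq_sqrt (by positivity)⟩
    have hg2 : g ^ 2 = w ^ 2 * h ^ 2 := by
      rcases hg with rfl | rfl <;> ring
    have hD : h ^ 2 - g ≠ 0 := by
      intro h0
      apply hwh
      apply mul_right_cancel₀ hh2.ne'
      linear_combination -hg2 - (h ^ 2 + g) * h0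
    have hm : u - w ≠ 0 := by
      intro h0
      have : g = 0 := by linear_combination (u + w) * h0 - hu
      exact hg0.ne' this
    have hp : u + w ≠ 0 := by
      intro h0
      have : g = 0 := by linear_combination (u - w) * h0 - hu
      exact hg0.ne' this
    refine PedalEquiv.of_pedal (framePoint O v (m + u) 0) ?_ ?_
    · rw [hP]
      refine noThreeCollinear_quad (not_collinear_frame hv ?_) (not_collinear_frame hv ?_)
        (not_collinear_frame hv ?_) (not_collinear_frame hv ?_)
      · convert mul_ne_zero (mul_ne_zero two_ne_zero hh) hp using 1
        ring
      · convert mul_ne_zero (mul_ne_zero two_ne_zero hh) hw using 1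
        ring
      · convert mul_ne_zero (mul_ne_zero (neg_ne_zero.2 two_ne_zero) hh) hm using 1
        ring
      · convert mul_ne_zero (mul_ne_zero two_ne_zero hh) hw using 1
        ring
    · rw [hP]
      have hQ : pedal (quad (framePoint O v (m + u) h) (framePoint O v (m - w) 0)
          (framePoint O v (m + u) (-h)) (framePoint O v (m + w) 0))
          (framePoint O v (m + u - 2 * u * h ^ 2 / (h ^ 2 - g)) 0) =
          quad (framePoint O v (m + u - (w + u) * h ^ 2 / (h ^ 2 - g)) (-g * h / (h ^ 2 - g)))
            (framePoint O v (m + u - (w + u) * h ^ 2 / (h ^ 2 - g)) (g * h / (h ^ 2 - g)))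
            (framePoint O v (m + u + (w - u) * h ^ 2 / (h ^ 2 - g)) (g * h / (h ^ 2 - g)))
            (framePoint O v (m + u + (w - u) * h ^ 2 / (h ^ 2 - g)) (-g * h / (h ^ 2 - g))) := by
        refine pedal_quad_eq (frame_foot hv (Or.inr hh) ?_ ?_)
          (frame_foot hv (Or.inr fun h => hh (by linarith)) ?_ ?_)
          (frame_foot hv (Or.inr fun h => hh (by linarith)) ?_ ?_)
          (frame_foot hv (Or.inr hh.symm) ?_ ?_)
        all_goals first
          | (field_simp; ring1)
          | linear_combination (h ^ 2 / (h ^ 2 - g)) * hu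
          | linear_combination -(h ^ 2 / (h ^ 2 - g)) * hu
      refine IsSquareGon.pedalEquiv_of_pedal
        (framePoint O v (m + u - 2 * u * h ^ 2 / (h ^ 2 - g)) 0) ?_ hV
      rw [hQ]
      refine isSquareGon_frame hv (Or.inr ?_) ?_ (by ring) (by ring)
      · have : g * h / (h ^ 2 - g) ≠ 0 := by positivity
        intro h0
        apply this
        linear_combination -h0 / 2
      · rcases hg with rfl | rfl
        · right
          constructor <;> ring
        · left
          constructor <;> ring

/-- The pedal quadrilateral of such a kite at a suitable point of its axis is a rectangle. -/
lemma pedalEquiv_kite_of_mul_ne_one (hv : v 0 ^ 2 + v 1 ^ 2 ≠ 0) (hV : IsSquareGon V) {p q : ℝ}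
    (hp : p ≠ 0) (hq : q ≠ 0) (hpq : p ≠ q) (h1 : p * q ≠ 1) :
    PedalEquiv (quad (framePoint O v p 0) (framePoint O v 0 1) (framePoint O v q 0)
      (framePoint O v 0 (-1))) V := by
  have hE : 1 - p * q ≠ 0 := sub_ne_zero.2 h1.symm
  have hsub : p - q ≠ 0 := sub_ne_zero.2 hpq
  obtain ⟨m, hm⟩ : ∃ m, m = (p + q) / 2 / (1 - p * q) := ⟨_, rfl⟩
  obtain ⟨w, hw⟩ : ∃ w, w = (p - q) / 2 / (1 - p * q) := ⟨_, rfl⟩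
  obtain ⟨h, hh⟩ : ∃ h, h = -(p * q) / (1 - p * q) := ⟨_, rfl⟩
  have hw0 : w ≠ 0 := by rw [hw]; positivity
  have hh0 : h ≠ 0 := by rw [hh]; exact div_ne_zero (neg_ne_zero.2 (mul_ne_zero hp hq)) hE
  have hP : pedal (quad (framePoint O v p 0) (framePoint O v 0 1) (framePoint O v q 0)
      (framePoint O v 0 (-1))) (framePoint O v ((p + q) / (1 - p * q)) 0) =
      quad (framePoint O v (m + w) h) (framePoint O v (m - w) h)
        (framePoint O v (m - w) (-h)) (framePoint O v (m + w) (-h)) := by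
    subst hm hw hh
    refine pedal_quad_eq (frame_foot hv (Or.inr zero_ne_one) ?_ ?_)
      (frame_foot hv (Or.inr one_ne_zero) ?_ ?_)
      (frame_foot hv (Or.inr (by norm_num)) ?_ ?_)
      (frame_foot hv (Or.inr (by norm_num)) ?_ ?_) <;>
      (field_simp; ring1)
  refine PedalEquiv.of_pedal (framePoint O v ((p + q) / (1 - p * q)) 0) ?_ ?_
  · rw [hP]
    refine noThreeCollinear_quad (not_collinear_frame hv ?_) (not_collinear_frame hv ?_)
      (not_collinear_frame hv ?_) (not_collinear_frame hv ?_) <;> ring_nf <;> simp [hw0, hh0]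
  · rw [hP]
    exact pedalEquiv_rectangle hv hV m hw0 hh0

/-- A suitable point of the axis of such a kite gives an isosceles trapezoid whose altitude equals
its midsegment, and the pedal quadrilateral of that trapezoid whose vertices are the midpoints of
its sides is a square. -/
lemma pedalEquiv_kite_of_mul_eq_one (hv : v 0 ^ 2 + v 1 ^ 2 ≠ 0) (hV : IsSquareGon V) {p q : ℝ}
    (hpq : p ≠ q) (h1 : p * q = 1) :
    PedalEquiv (quad (framePoint O v p 0) (framePoint O v 0 1) (framePoint O v q 0)
      (framePoint O v 0 (-1))) V := by
  have hp : p ≠ 0 := left_ne_zero_of_mul_eq_one h1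
  obtain rfl : q = 1 / p := by field_simp; linear_combination h1
  have hp2 : p ^ 2 - 1 ≠ 0 := by
    intro h
    apply hpq
    field_simp
    linear_combination h
  have hN : p ^ 2 + 1 ≠ 0 := by positivity
  obtain ⟨s, hs2, hs⟩ : ∃ s : ℝ, s ^ 2 = 1 ∧ 2 * p + s * (p ^ 2 - 1) ≠ 0 := by
    by_cases h : 2 * p + 1 * (p ^ 2 - 1) = 0
    · refine ⟨-1, by norm_num, fun h' => hp ?_⟩
      linear_combination (h + h') / 4
    · exact ⟨1, by norm_num, h⟩
  obtain ⟨r, hr⟩ : ∃ r, r * (2 * p + s * (p ^ 2 - 1)) = p ^ 2 + 1 :=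
    ⟨(p ^ 2 + 1) / (2 * p + s * (p ^ 2 - 1)), div_mul_cancel₀ _ hs⟩
  have hr0 : r ≠ 0 := left_ne_zero_of_mul (hr.symm ▸ hN)
  have hsp : 1 + s * p ≠ 0 := by
    intro h
    apply hp2
    linear_combination (s * p - 1) * h - p ^ 2 * hs2
  have hps : s - p ≠ 0 := by
    intro h
    apply hp2
    linear_combination -(s + p) * h + hs2
  have hrp : p - r ≠ 0 := by
    intro h
    apply mul_ne_zero hp2 hsp
    linear_combination hr + (2 * p + s * (p ^ 2 - 1)) * h
  have hrq : 1 - r * p ≠ 0 := by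
    intro h
    apply mul_ne_zero hp2 hps
    linear_combination p * hr + (2 * p + s * (p ^ 2 - 1)) * h
  have hP : pedal (quad (framePoint O v p 0) (framePoint O v 0 1) (framePoint O v (1 / p) 0)
      (framePoint O v 0 (-1))) (framePoint O v r 0) =
      quad (framePoint O v (p * (r * p + 1) / (p ^ 2 + 1)) (p * (p - r) / (p ^ 2 + 1)))
        (framePoint O v ((r + p) / (p ^ 2 + 1)) ((1 - r * p) / (p ^ 2 + 1)))
        (framePoint O v ((r + p) / (p ^ 2 + 1)) (-((1 - r * p) / (p ^ 2 + 1))))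
        (framePoint O v (p * (r * p + 1) / (p ^ 2 + 1)) (-(p * (p - r) / (p ^ 2 + 1)))) := by
    refine pedal_quad_eq (frame_foot hv (Or.inr zero_ne_one) ?_ ?_)
      (frame_foot hv (Or.inr one_ne_zero) ?_ ?_)
      (frame_foot hv (Or.inr (by norm_num)) ?_ ?_)
      (frame_foot hv (Or.inr (by norm_num)) ?_ ?_) <;>
      (field_simp; ring1)
  have hx : p * (r * p + 1) / (p ^ 2 + 1) - (r + p) / (p ^ 2 + 1) ≠ 0 := by
    convert div_ne_zero (mul_ne_zero hr0 hp2) hN using 1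
    ring
  have hy : p * (p - r) / (p ^ 2 + 1) ≠ 0 := by positivity
  have hy' : (1 - r * p) / (p ^ 2 + 1) ≠ 0 := by positivity
  refine PedalEquiv.of_pedal (framePoint O v r 0) ?_ ?_
  · rw [hP]
    generalize p * (r * p + 1) / (p ^ 2 + 1) = a at *
    generalize p * (p - r) / (p ^ 2 + 1) = b at *
    generalize (r + p) / (p ^ 2 + 1) = c at *
    generalize (1 - r * p) / (p ^ 2 + 1) = d at *
    refine noThreeCollinear_quad (not_collinear_frame hv ?_) (not_collinear_frame hv ?_)
      (not_collinear_frame hv ?_) (not_collinear_frame hv ?_)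
    · convert mul_ne_zero (mul_ne_zero two_ne_zero hx) hy' using 1
      ring
    · convert mul_ne_zero (mul_ne_zero two_ne_zero hx) hy' using 1
      ring
    · convert mul_ne_zero (mul_ne_zero two_ne_zero hx) hy using 1
      ring
    · convert mul_ne_zero (mul_ne_zero two_ne_zero hx) hy using 1
      ring
  · rw [hP]
    have hQ : pedal (quad
        (framePoint O v (p * (r * p + 1) / (p ^ 2 + 1)) (p * (p - r) / (p ^ 2 + 1)))
        (framePoint O v ((r + p) / (p ^ 2 + 1)) ((1 - r * p) / (p ^ 2 + 1)))
        (framePoint O v ((r + p) / (p ^ 2 + 1)) (-((1 - r * p) / (p ^ 2 + 1))))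
        (framePoint O v (p * (r * p + 1) / (p ^ 2 + 1)) (-(p * (p - r) / (p ^ 2 + 1)))))
        (framePoint O v ((r + 1 / r) / 2) 0) =
        quad (framePoint O v ((p * (r * p + 1) + (r + p)) / (p ^ 2 + 1) / 2)
            ((p * (p - r) + (1 - r * p)) / (p ^ 2 + 1) / 2))
          (framePoint O v ((r + p) / (p ^ 2 + 1)) 0)
          (framePoint O v ((p * (r * p + 1) + (r + p)) / (p ^ 2 + 1) / 2)
            (-((p * (p - r) + (1 - r * p)) / (p ^ 2 + 1) / 2)))
          (framePoint O v (p * (r * p + 1) / (p ^ 2 + 1)) 0) := by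
      refine pedal_quad_eq (frame_foot hv (Or.inl (sub_ne_zero.1 hx)) ?_ ?_)
        (frame_foot hv (Or.inr fun h => hy' (by linarith)) ?_ ?_)
        (frame_foot hv (Or.inl (sub_ne_zero.1 hx).symm) ?_ ?_)
        (frame_foot hv (Or.inr fun h => hy (by linarith)) ?_ ?_) <;>
        (field_simp; ring1)
    refine IsSquareGon.pedalEquiv_of_pedal (framePoint O v ((r + 1 / r) / 2) 0) ?_ hV
    rw [hQ]
    refine isSquareGon_frame hv (Or.inl fun h => hx ?_) ?_ (by ring) (by ring)
    · linear_combination 2 * h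
    · rcases sq_eq_one_iff.1 hs2 with rfl | rfl
      · left
        constructor
        · linear_combination hr / (p ^ 2 + 1) / 2
        · linear_combination hr / (p ^ 2 + 1) / 2
      · right
        constructor
        · linear_combination -hr / (p ^ 2 + 1) / 2
        · linear_combination hr / (p ^ 2 + 1) / 2

end Frame

/-- In a suitable frame, a kite has vertices `(p, 0)`, `(0, 1)`, `(q, 0)`, `(0, -1)`. -/
lemma IsKite.exists_frame {K : ZMod 4 → Plane} (hK : IsKite K) :
    ∃ (O v : Plane) (p q : ℝ), v 0 ^ 2 + v 1 ^ 2 ≠ 0 ∧ p ≠ 0 ∧ q ≠ 0 ∧ p ≠ q ∧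
      K = quad (framePoint O v p 0) (framePoint O v 0 1) (framePoint O v q 0)
        (framePoint O v 0 (-1)) := by
  obtain ⟨hc, h0, h2⟩ := hK
  obtain ⟨v, hv⟩ : ∃ v : Plane, v = (1 / 2 : ℝ) • (K 1 - K 3) := ⟨_, rfl⟩
  obtain ⟨O, hO⟩ : ∃ O : Plane, O = (1 / 2 : ℝ) • (K 1 + K 3) := ⟨_, rfl⟩
  have hv0 : v 0 = (K 1 0 - K 3 0) / 2 := by rw [hv]; simp; ring
  have hv1 : v 1 = (K 1 1 - K 3 1) / 2 := by rw [hv]; simp; ring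
  have hO0 : O 0 = (K 1 0 + K 3 0) / 2 := by rw [hO]; simp; ring
  have hO1 : O 1 = (K 1 1 + K 3 1) / 2 := by rw [hO]; simp; ring
  have hn : v 0 ^ 2 + v 1 ^ 2 ≠ 0 := by
    intro h
    have h13 : K 1 = K 3 := by
      apply plane_ext <;> nlinarith [sq_nonneg (v 0), sq_nonneg (v 1)]
    apply hc 1
    change Collinear ℝ ({K 1, K 2, K 3} : Set Plane)
    rw [plane_collinear_iff, h13]
    ring
  have axis {A : Plane} (h : dist A (K 1) = dist A (K 3)) :
      ∃ x, A = framePoint O v x 0 := by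
    have h' : dist A (K 1) ^ 2 = dist A (K 3) ^ 2 := by rw [h]
    rw [plane_dist_sq, plane_dist_sq] at h'
    have ho : (A 0 - O 0) * v 0 + (A 1 - O 1) * v 1 = 0 := by
      rw [hv0, hv1, hO0, hO1]
      linear_combination -h' / 4
    refine ⟨((A 0 - O 0) * v 1 - (A 1 - O 1) * v 0) / (v 0 ^ 2 + v 1 ^ 2), ?_⟩
    apply plane_ext <;> simp [framePoint] <;> field_simp
    · linear_combination v 0 * ho
    · linear_combination v 1 * ho
  obtain ⟨p, hp⟩ := axis h0
  obtain ⟨q, hq⟩ := axis h2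
  have hK1 : K 1 = framePoint O v 0 1 := by
    apply plane_ext <;> simp [framePoint, hv0, hv1, hO0, hO1] <;> ring
  have hK3 : K 3 = framePoint O v 0 (-1) := by
    apply plane_ext <;> simp [framePoint, hv0, hv1, hO0, hO1] <;> ring
  refine ⟨O, v, p, q, hn, ?_, ?_, ?_, ?_⟩
  · rintro rfl
    apply hc 3
    change Collinear ℝ ({K 3, K 0, K 1} : Set Plane)
    rw [hK3, hp, hK1, frame_collinear_iff hn]
    ring
  · rintro rfl
    apply hc 1
    change Collinear ℝ ({K 1, K 2, K 3} : Set Plane)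
    rw [hK3, hq, hK1, frame_collinear_iff hn]
    ring
  · rintro rfl
    apply hc 0
    change Collinear ℝ ({K 0, K 1, K 2} : Set Plane)
    rw [hp, hq, hK1, frame_collinear_iff hn]
    ring
  · funext i
    fin_cases i
    · exact hp
    · exact hK1
    · exact hq
    · exact hK3

/-- **Every kite is pedal equivalent to every square.** -/
theorem kite_pedalEquiv_square
    (K V : ZMod 4 → Plane) (hK : IsKite K) (hV : IsSquareGon V) :
    PedalEquiv K V := by
  obtain ⟨O, v, p, q, hv, hp, hq, hpq, rfl⟩ := hK.exists_frame
  by_cases h1 : p * q = 1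
  · exact pedalEquiv_kite_of_mul_eq_one hv hV hpq h1
  · exact pedalEquiv_kite_of_mul_ne_one hv hV hp hq hpq h1
end
end
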